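/- Rigidity of two-fold degenerate magic angles (second implication of the Rigidity Theorem): Let U be a tunnelling potential which additionally satisfies conj(U(conj z)) = −U(−z) for all z ∈ ℂ, and consider the chiral model D(α) built from U. If α ∈ ℂ is a two-fold degenerate magic parameter, i.e. dim_ℂ Ker(α,k) = 2 for every k ∈ ℂ (flat band of multiplicity four), then dim_ℂ Ker₀(α) = 1 and dim_ℂ Ker₁(α) = 1. -/

import Mathlib

noncomputable section

open Complex MeasureTheory

namespace TBG

/-- `ω = exp(2πi/3)`. -/
def ω : ℂ := Complex.exp (2 * Real.pi * Complex.I / 3)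

/-- The moiré lattice `Λ = ℤω + ℤ ⊂ ℂ`. -/
def Λ : Set ℂ := {z : ℂ | ∃ m n : ℤ, z = m * ω + n}

/-- The dual lattice `Λ* = (4πi/√3)·Λ`. -/
def Λdual : Set ℂ := {p : ℂ | ∃ m n : ℤ, p = 4 * Real.pi * Complex.I / Real.sqrt 3 * (m * ω + n)}

/-- The high symmetry point `K = 4π/3`. -/
def K : ℂ := 4 * Real.pi / 3

/-- `⟨z,w⟩ = Re (z · conj w)`. -/
def pair (z w : ℂ) : ℝ := (z * (starRingEnd ℂ) w).re

/-- `2 D_z̄ f = (1/i)(∂_x f + i ∂_y f)`. -/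
def Dbar (f : ℂ → ℂ) (z : ℂ) : ℂ :=
  1 / Complex.I * (fderiv ℝ f z 1 + Complex.I * fderiv ℝ f z Complex.I)

/-- A tunnelling potential: smooth, with the translational and rotational symmetries. -/
def IsTunnelling (U : ℂ → ℂ) : Prop :=
  ContDiff ℝ (⊤ : ℕ∞) U ∧
    (∀ γ ∈ Λ, ∀ z : ℂ, U (z + γ) = Complex.exp (Complex.I * (pair γ K : ℂ)) * U z) ∧
    ∀ z : ℂ, U (ω * z) = ω * U z

/-- Membership in `ker_{L²₀}(D(α)+k)` for the chiral model with tunnelling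
potentials `U₊ = Up`, `U₋ = Um`: smooth solutions of `(D(α)+k)u = 0` with the
Floquet boundary conditions. -/
def InKer (Up Um : ℂ → ℂ) (α k : ℂ) (u : ℂ → ℂ × ℂ) : Prop :=
  ContDiff ℝ (⊤ : ℕ∞) u ∧
    (∀ z : ℂ, Dbar (fun w => (u w).1) z + k * (u z).1 + α * Up z * (u z).2 = 0) ∧
    (∀ z : ℂ, Dbar (fun w => (u w).2) z + k * (u z).2 + α * Um z * (u z).1 = 0) ∧
    (∀ γ ∈ Λ, ∀ z : ℂ, (u (z + γ)).1 = Complex.exp (-Complex.I * (pair γ K : ℂ)) * (u z).1) ∧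
    (∀ γ ∈ Λ, ∀ z : ℂ, (u (z + γ)).2 = Complex.exp (Complex.I * (pair γ K : ℂ)) * (u z).2)

/-- `Ker(α,k)` as a set of functions. -/
def kerSet (Up Um : ℂ → ℂ) (α k : ℂ) : Set (ℂ → ℂ × ℂ) := {u | InKer Up Um α k u}

/-- `dim_ℂ Ker(α,k)` (the set `Ker(α,k)` is a linear subspace, so the finrank of its span
is its dimension). -/
def kerDim (Up Um : ℂ → ℂ) (α k : ℂ) : ℕ :=
  Module.finrank ℂ ↥(Submodule.span ℂ (kerSet Up Um α k))

/-- `Ker_p(α) = {u ∈ Ker(α,0) : u(ωz) = ω^(−p)·u(z)}`. -/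
def kerPSet (Up Um : ℂ → ℂ) (α : ℂ) (p : ℕ) : Set (ℂ → ℂ × ℂ) :=
  {u | u ∈ kerSet Up Um α 0 ∧ ∀ z : ℂ, u (ω * z) = (ω ^ (-(p : ℤ))) • u z}

/-- `dim_ℂ Ker_p(α)`. -/
def kerPDim (Up Um : ℂ → ℂ) (α : ℂ) (p : ℕ) : ℕ :=
  Module.finrank ℂ ↥(Submodule.span ℂ (kerPSet Up Um α p))

/-- `α` is magic: the flat band condition `Ker(α,k) ≠ {0}` for every `k`. -/
def IsMagic (Up Um : ℂ → ℂ) (α : ℂ) : Prop :=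
  ∀ k : ℂ, ∃ u ∈ kerSet Up Um α k, u ≠ 0


section

open scoped ContDiff Topology
open Filter

/-! ### Averages along rays -/

/-- The weighted average `∫₀¹ tᵐ h(tz) dt` of `h` along the segment from `0` to `z`. -/
def rayInt {E : Type} [NormedAddCommGroup E] [NormedSpace ℝ E] (m : ℕ) (h : ℂ → E) (z : ℂ) : E :=
  ∫ t in (0 : ℝ)..1, t ^ m • h (t • z)

lemma hasFDerivAt_rayInt {E : Type} [NormedAddCommGroup E] [NormedSpace ℝ E]
    (m : ℕ) {h : ℂ → E} (hh : ContDiff ℝ 1 h) (z : ℂ) :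
    HasFDerivAt (rayInt m h) (rayInt (m + 1) (fderiv ℝ h) z) z := by
  have hc : Continuous h := hh.continuous
  have hc' : Continuous (fderiv ℝ h) := hh.continuous_fderiv one_ne_zero
  obtain ⟨C, hC⟩ := (isCompact_closedBall (0 : ℂ) (‖z‖ + 1)).exists_bound_of_continuousOn
    hc'.continuousOn
  refine intervalIntegral.hasFDerivAt_integral_of_dominated_of_fderiv_le
    (F := fun x t => t ^ m • h (t • x)) (F' := fun x t => t ^ (m + 1) • fderiv ℝ h (t • x))
    (bound := fun _ => C) (Metric.ball_mem_nhds z one_pos) ?_ ?_ ?_ ?_ ?_ ?_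
  · exact Eventually.of_forall fun x => (by fun_prop : Continuous _).aestronglyMeasurable
  · exact (by fun_prop : Continuous _).intervalIntegrable _ _
  · have : SecondCountableTopologyEither ℝ (ℂ →L[ℝ] E) :=
      secondCountableTopologyEither_of_left _ _
    exact (by fun_prop : Continuous _).aestronglyMeasurable
  · refine Eventually.of_forall fun t ht x hx => ?_
    rw [Set.uIoc_of_le zero_le_one] at ht
    have hx' : ‖x‖ ≤ ‖z‖ + 1 := by
      have h1 := norm_sub_norm_le x z
      have h2 : ‖x - z‖ < 1 := by simpa [dist_eq_norm] using hx
      linarith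
    have hb : ‖fderiv ℝ h (t • x)‖ ≤ C := by
      refine hC _ ?_
      rw [mem_closedBall_zero_iff, norm_smul, Real.norm_of_nonneg ht.1.le]
      nlinarith [norm_nonneg x, ht.1, ht.2]
    rw [norm_smul, norm_pow, Real.norm_of_nonneg ht.1.le]
    have hp : t ^ (m + 1) ≤ 1 := pow_le_one₀ ht.1.le ht.2
    have hp' : 0 ≤ t ^ (m + 1) := pow_nonneg ht.1.le _
    nlinarith [norm_nonneg (fderiv ℝ h (t • x))]
  · exact intervalIntegrable_const
  · refine Eventually.of_forall fun t _ x _ => ?_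
    have h1 : HasFDerivAt h (fderiv ℝ h (t • x)) (t • x) :=
      (hh.differentiable one_ne_zero _).hasFDerivAt
    have h2 : HasFDerivAt (fun y : ℂ => t • y) (t • ContinuousLinearMap.id ℝ ℂ) x :=
      (hasFDerivAt_id x).const_smul t
    have h3 := (h1.comp x h2).const_smul (t ^ m)
    convert! h3 using 1
    ext v
    simp [pow_succ, smul_smul]

lemma contDiff_nat_rayInt (n : ℕ) : ∀ {E : Type} [NormedAddCommGroup E] [NormedSpace ℝ E]
    (m : ℕ) {h : ℂ → E}, ContDiff ℝ ∞ h → ContDiff ℝ n (rayInt m h) := by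
  induction n with
  | zero =>
    intro E _ _ m h hh
    have : Differentiable ℝ (rayInt m h) := fun z =>
      (hasFDerivAt_rayInt m (hh.of_le (by exact_mod_cast le_top)) z).differentiableAt
    exact contDiff_zero.2 this.continuous
  | succ n ih =>
    intro E _ _ m h hh
    push_cast
    exact contDiff_succ_iff_hasFDerivAt.2 ⟨rayInt (m + 1) (fderiv ℝ h),
      ih (m + 1) (hh.fderiv_right (by exact_mod_cast le_top)),
      hasFDerivAt_rayInt m (hh.of_le (by exact_mod_cast le_top))⟩

lemma contDiff_rayInt {E : Type} [NormedAddCommGroup E] [NormedSpace ℝ E]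
    (m : ℕ) {h : ℂ → E} (hh : ContDiff ℝ ∞ h) : ContDiff ℝ ∞ (rayInt m h) :=
  contDiff_infty.2 fun n => contDiff_nat_rayInt n m hh

/-! ### The operator `Dbar` -/

lemma contDiff_Dbar {f : ℂ → ℂ} (hf : ContDiff ℝ ∞ f) : ContDiff ℝ ∞ (Dbar f) := by
  have h1 : ContDiff ℝ ∞ (fderiv ℝ f) := hf.fderiv_right (by exact_mod_cast le_top)
  unfold Dbar
  fun_prop

lemma Dbar_add {f g : ℂ → ℂ} {z : ℂ} (hf : DifferentiableAt ℝ f z)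
    (hg : DifferentiableAt ℝ g z) :
    Dbar (fun w => f w + g w) z = Dbar f z + Dbar g z := by
  simp only [Dbar, fderiv_fun_add hf hg, add_apply]
  ring

lemma Dbar_mul {f g : ℂ → ℂ} {z : ℂ} (hf : DifferentiableAt ℝ f z)
    (hg : DifferentiableAt ℝ g z) :
    Dbar (fun w => f w * g w) z = f z * Dbar g z + Dbar f z * g z := by
  simp only [Dbar, fderiv_fun_mul hf hg, add_apply,
    smul_apply, smul_eq_mul]
  ring

lemma Dbar_of_differentiableAt {f : ℂ → ℂ} {z : ℂ} (hf : DifferentiableAt ℂ f z) :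
    Dbar f z = 0 := by
  have h : fderiv ℝ f z = (fderiv ℂ f z).restrictScalars ℝ :=
    (hf.hasFDerivAt.restrictScalars ℝ).fderiv
  have h2 : fderiv ℂ f z I = I * fderiv ℂ f z 1 := by
    simp
  rw [Dbar, h]
  simp only [ContinuousLinearMap.coe_restrictScalars', h2]
  linear_combination (1 / I) * fderiv ℂ f z 1 * I_mul_I

lemma Dbar_comp_add_left (f : ℂ → ℂ) (a z : ℂ) :
    Dbar (fun w => f (a + w)) z = Dbar f (a + z) := by
  simp only [Dbar, fderiv_comp_add_left]

lemma Dbar_rayInt (m : ℕ) {h : ℂ → ℂ} (hh : ContDiff ℝ ∞ h) :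
    Dbar (rayInt m h) = rayInt (m + 1) (Dbar h) := by
  funext z
  have h1 : ContDiff ℝ 1 h := hh.of_le (by exact_mod_cast le_top)
  have hc' : Continuous (fderiv ℝ h) := h1.continuous_fderiv one_ne_zero
  have hi : IntervalIntegrable (fun t : ℝ => t ^ (m + 1) • fderiv ℝ h (t • z)) volume 0 1 :=
    (by fun_prop : Continuous _).intervalIntegrable _ _
  have hv : ∀ v : ℂ, rayInt (m + 1) (fderiv ℝ h) z v
      = ∫ t in (0 : ℝ)..1, t ^ (m + 1) • fderiv ℝ h (t • z) v := fun v =>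
    ContinuousLinearMap.intervalIntegral_apply hi v
  have hiv : ∀ v : ℂ, IntervalIntegrable (fun t : ℝ => t ^ (m + 1) • fderiv ℝ h (t • z) v)
      volume 0 1 := fun v =>
    (by fun_prop : Continuous _).intervalIntegrable _ _
  rw [Dbar, (hasFDerivAt_rayInt m h1 z).fderiv, hv, hv, ← intervalIntegral.integral_const_mul,
    ← intervalIntegral.integral_add (hiv 1) ((hiv I).const_mul I),
    ← intervalIntegral.integral_const_mul, rayInt]
  congr 1
  funext t
  simp only [Dbar, Complex.real_smul]
  ring

/-- Hadamard's lemma in complex coordinates. -/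
lemma exists_eq_mul_add_conj_mul {f : ℂ → ℂ} (hf : ContDiff ℝ ∞ f) (h0 : f 0 = 0) :
    ∃ a : ℂ → ℂ, ContDiff ℝ ∞ a ∧
      ∀ z, f z = z * a z + (starRingEnd ℂ) z * (I / 2 * rayInt 0 (Dbar f) z) := by
  have h1 : ContDiff ℝ 1 f := hf.of_le (by exact_mod_cast le_top)
  have hc' : Continuous (fderiv ℝ f) := h1.continuous_fderiv one_ne_zero
  have hD : ContDiff ℝ ∞ (fderiv ℝ f) := hf.fderiv_right (by exact_mod_cast le_top)
  have hda : ContDiff ℝ ∞ (fun w => (fderiv ℝ f w 1 - I * fderiv ℝ f w I) / 2) := by fun_prop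
  refine ⟨rayInt 0 fun w => (fderiv ℝ f w 1 - I * fderiv ℝ f w I) / 2, contDiff_rayInt 0 hda,
    fun z => ?_⟩
  have hftc : ∫ t in (0 : ℝ)..1, fderiv ℝ f (t • z) z = f z := by
    have := intervalIntegral.integral_eq_sub_of_hasDerivAt (a := 0) (b := 1)
      (f := fun t : ℝ => f (t • z)) (f' := fun t : ℝ => fderiv ℝ f (t • z) z) (fun t _ => by
        have h2 : HasFDerivAt f (fderiv ℝ f (t • z)) (t • z) :=
          (h1.differentiable one_ne_zero _).hasFDerivAt
        have h3 : HasDerivAt (fun t : ℝ => t • z) z t := by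
          simpa using (hasDerivAt_id t).smul_const z
        exact h2.comp_hasDerivAt t h3)
      ((by fun_prop : Continuous _).intervalIntegrable _ _)
    simpa [h0] using this
  have hcb : Continuous (Dbar f) := (contDiff_Dbar hf).continuous
  have hca := hda.continuous
  have hia : IntervalIntegrable
      (fun t : ℝ => z * (t ^ 0 • ((fderiv ℝ f (t • z) 1 - I * fderiv ℝ f (t • z) I) / 2)))
      volume 0 1 :=
    (by fun_prop : Continuous _).intervalIntegrable _ _
  have hib : IntervalIntegrable
      (fun t : ℝ => (starRingEnd ℂ) z * (I / 2 * (t ^ 0 • Dbar f (t • z)))) volume 0 1 :=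
    (by fun_prop : Continuous _).intervalIntegrable _ _
  rw [← hftc, rayInt, rayInt, ← intervalIntegral.integral_const_mul,
    ← intervalIntegral.integral_const_mul, ← intervalIntegral.integral_const_mul,
    ← intervalIntegral.integral_add hia hib]
  congr 1
  funext t
  have hz : fderiv ℝ f (t • z) z = z.re * fderiv ℝ f (t • z) 1 + z.im * fderiv ℝ f (t • z) I := by
    conv_lhs => rw [show z = z.re • (1 : ℂ) + z.im • I by simp [Complex.re_add_im]]
    rw [map_add, map_smul, map_smul]
    simp
  rw [hz]
  simp only [Dbar, pow_zero, one_smul]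
  set p := fderiv ℝ f (t • z) 1
  set q := fderiv ℝ f (t • z) I
  have e1 : (z.re : ℂ) = (z + (starRingEnd ℂ) z) / 2 := Complex.re_eq_add_conj z
  have e2 : (z.im : ℂ) = (z - (starRingEnd ℂ) z) / (2 * I) := Complex.im_eq_sub_conj z
  rw [e1, e2]
  field_simp
  ring_nf
  simp only [I_sq]
  ring

/-! ### Division by a holomorphic coordinate -/

/-- The iterates `Dbar^k f`, `k ≤ n`, all vanish at `0`. -/
def DbarFlat : ℕ → (ℂ → ℂ) → Prop
  | 0, f => f 0 = 0
  | n + 1, f => f 0 = 0 ∧ DbarFlat n (Dbar f)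

lemma DbarFlat.of_succ {n : ℕ} : ∀ {f : ℂ → ℂ}, DbarFlat (n + 1) f → DbarFlat n f := by
  induction n with
  | zero => exact fun h => h.1
  | succ n ih => exact fun h => ⟨h.1, ih h.2⟩

lemma DbarFlat.add {n : ℕ} : ∀ {f g : ℂ → ℂ}, ContDiff ℝ ∞ f → ContDiff ℝ ∞ g →
    DbarFlat n f → DbarFlat n g → DbarFlat n (fun z => f z + g z) := by
  induction n with
  | zero =>
    intro f g _ _ h1 h2
    simp only [DbarFlat] at *
    simp [h1, h2]
  | succ n ih =>
    intro f g hf hg h1 h2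
    refine ⟨by simp [h1.1, h2.1], ?_⟩
    have e : Dbar (fun z => f z + g z) = fun z => Dbar f z + Dbar g z := funext fun z =>
      Dbar_add (hf.differentiable (by simp) z) (hg.differentiable (by simp) z)
    rw [e]
    exact ih (contDiff_Dbar hf) (contDiff_Dbar hg) h1.2 h2.2

lemma DbarFlat.mul_left {n : ℕ} : ∀ {a f : ℂ → ℂ}, ContDiff ℝ ∞ a → ContDiff ℝ ∞ f →
    DbarFlat n f → DbarFlat n (fun z => a z * f z) := by
  induction n with
  | zero =>
    intro a f _ _ h
    simp only [DbarFlat] at *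
    simp [h]
  | succ n ih =>
    intro a f ha hf h
    refine ⟨by simp [h.1], ?_⟩
    have e : Dbar (fun z => a z * f z) = fun z => a z * Dbar f z + Dbar a z * f z :=
      funext fun z => Dbar_mul (ha.differentiable (by simp) z) (hf.differentiable (by simp) z)
    rw [e]
    have hb := contDiff_Dbar hf
    have hc := contDiff_Dbar ha
    exact DbarFlat.add (by fun_prop) (by fun_prop) (ih ha hb h.2) (ih hc hf h.of_succ)

lemma DbarFlat.rayInt {n : ℕ} : ∀ {f : ℂ → ℂ} (m : ℕ), ContDiff ℝ ∞ f →
    DbarFlat n f → DbarFlat n (rayInt m f) := by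
  induction n with
  | zero =>
    intro f m _ h
    simp only [DbarFlat] at *
    simp [TBG.rayInt, h]
  | succ n ih =>
    intro f m hf h
    refine ⟨by simp [TBG.rayInt, h.1], ?_⟩
    rw [Dbar_rayInt m hf]
    exact ih _ (contDiff_Dbar hf) h.2

lemma exists_eq_mul_add_conj_pow_mul {f : ℂ → ℂ} (hf : ContDiff ℝ ∞ f)
    (hflat : ∀ n, DbarFlat n f) (n : ℕ) :
    ∃ a b : ℂ → ℂ, ContDiff ℝ ∞ a ∧ ContDiff ℝ ∞ b ∧ (∀ k, DbarFlat k b) ∧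
      ∀ z, f z = z * a z + (starRingEnd ℂ) z ^ n * b z := by
  induction n with
  | zero => exact ⟨fun _ => 0, f, contDiff_const, hf, hflat, fun z => by simp⟩
  | succ n ih =>
    obtain ⟨a, b, ha, hb, hbf, h⟩ := ih
    obtain ⟨a', ha', h'⟩ := exists_eq_mul_add_conj_mul hb (hbf 0)
    have hr := contDiff_rayInt 0 (contDiff_Dbar hb)
    have hconj : ContDiff ℝ ∞ (fun z : ℂ => (starRingEnd ℂ) z) := Complex.conjCLE.contDiff
    refine ⟨fun z => a z + (starRingEnd ℂ) z ^ n * a' z, fun z => I / 2 * rayInt 0 (Dbar b) z,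
      by fun_prop, by fun_prop, fun k => ?_, fun z => ?_⟩
    · exact DbarFlat.mul_left contDiff_const hr ((hbf (k + 1)).2.rayInt 0 (contDiff_Dbar hb))
    · rw [h, h']
      ring

lemma contDiff_conj_pow_div_pow (k : ℕ) : ∀ n b : ℕ, b + k + 1 ≤ n →
    ContDiff ℝ k (fun z : ℂ => (starRingEnd ℂ) z ^ n / z ^ b) := by
  have hnorm : ∀ n b : ℕ, b ≤ n → ∀ z : ℂ, z ≠ 0 →
      ‖(starRingEnd ℂ) z ^ n / z ^ b‖ = ‖z‖ ^ (n - b) := by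
    intro n b hb z hz
    rw [norm_div, norm_pow, norm_pow, RCLike.norm_conj, div_eq_iff (pow_ne_zero b (norm_ne_zero_iff.2 hz)),
      ← pow_add,
      Nat.sub_add_cancel hb]
  have hderiv : ∀ n b : ℕ, b + 2 ≤ n → ∀ z : ℂ,
      HasFDerivAt (fun z : ℂ => (starRingEnd ℂ) z ^ n / z ^ b)
        ((n * ((starRingEnd ℂ) z ^ (n - 1) / z ^ b)) • (Complex.conjCLE : ℂ →L[ℝ] ℂ)
          - (b * ((starRingEnd ℂ) z ^ n / z ^ (b + 1))) • ContinuousLinearMap.id ℝ ℂ) z := by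
    intro n b hb z
    rcases eq_or_ne z 0 with rfl | hz
    · have e : ((n * ((starRingEnd ℂ) (0 : ℂ) ^ (n - 1) / (0 : ℂ) ^ b)) •
          (Complex.conjCLE : ℂ →L[ℝ] ℂ)
          - (b * ((starRingEnd ℂ) (0 : ℂ) ^ n / (0 : ℂ) ^ (b + 1))) • ContinuousLinearMap.id ℝ ℂ)
          = 0 := by
        have h1 : n - 1 ≠ 0 := by omega
        have h2 : n ≠ 0 := by omega
        ext v
        simp [h1, h2]
      rw [e]
      refine HasFDerivAt.of_isLittleO ?_
      have hO : (fun z : ℂ => (starRingEnd ℂ) z ^ n / z ^ b) =O[𝓝 0] (fun z : ℂ => ‖z‖ ^ 2) := by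
        refine Asymptotics.IsBigO.of_bound 1 ?_
        filter_upwards [Metric.ball_mem_nhds (0 : ℂ) one_pos] with z hz
        rcases eq_or_ne z 0 with rfl | hz0
        · have h2 : n ≠ 0 := by omega
          simp [h2]
        · rw [hnorm n b (by omega) z hz0, one_mul, norm_pow, norm_norm]
          exact pow_le_pow_of_le_one (norm_nonneg _) (mem_ball_zero_iff.1 hz).le (by omega)
      have h2 : n ≠ 0 := by omega
      have := hO.trans_isLittleO
        ((Asymptotics.isLittleO_norm_pow_id (E' := ℂ) one_lt_two))
      simpa [h2] using this
    · have h1 : HasFDerivAt (fun z : ℂ => (starRingEnd ℂ) z ^ n)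
          ((n * (starRingEnd ℂ) z ^ (n - 1)) • (Complex.conjCLE : ℂ →L[ℝ] ℂ)) z := by
        have := (Complex.conjCLE : ℂ →L[ℝ] ℂ).hasFDerivAt (x := z) |>.pow n
        simpa [nsmul_eq_mul] using this
      have h2 : HasFDerivAt (fun z : ℂ => (z ^ b)⁻¹)
          ((-(b : ℂ) / z ^ (b + 1)) • ContinuousLinearMap.id ℝ ℂ) z := by
        have h3 : HasDerivAt (fun z : ℂ => (z ^ b)⁻¹) (-(b : ℂ) / z ^ (b + 1)) z := by
          convert! (hasDerivAt_pow b z).inv (pow_ne_zero b hz) using 1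
          rcases b with _ | b
          · simp
          · field_simp
            simp
            ring
        convert! h3.hasFDerivAt.restrictScalars ℝ using 1
        ext
        simp [mul_comm]
      convert! h1.mul h2 using 1
      ext
      simp
      field_simp
      ring
  induction k with
  | zero =>
    intro n b h
    refine contDiff_zero.2 (continuous_iff_continuousAt.2 fun z => ?_)
    rcases eq_or_ne z 0 with rfl | hz
    · have h2 : n ≠ 0 := by omega
      have h3 : n - b ≠ 0 := by omega
      rw [ContinuousAt, map_zero, zero_pow h2, zero_div]
      refine squeeze_zero_norm (a := fun z : ℂ => ‖z‖ ^ (n - b)) (fun z => ?_) ?_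
      · rcases eq_or_ne z 0 with rfl | hz
        · simp [h2, h3]
        · exact (hnorm n b (by omega) z hz).le
      · have : Continuous fun z : ℂ => ‖z‖ ^ (n - b) := by fun_prop
        simpa [h3] using this.tendsto 0
    · have : ContinuousAt (fun z : ℂ => (starRingEnd ℂ) z) z := Complex.continuous_conj.continuousAt
      exact ContinuousAt.div₀ (by fun_prop) (by fun_prop) (pow_ne_zero b hz)
  | succ k ih =>
    intro n b h
    push_cast
    refine contDiff_succ_iff_hasFDerivAt.2 ⟨_, ?_, hderiv n b (by omega)⟩
    have h1 := ih (n - 1) b (by omega)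
    have h2 := ih n (b + 1) (by omega)
    fun_prop

/-- A smooth function all of whose iterated `Dbar` derivatives vanish at `0` is
smoothly divisible by `z`. -/
lemma exists_eq_mul_of_DbarFlat {f : ℂ → ℂ} (hf : ContDiff ℝ ∞ f)
    (hflat : ∀ n, DbarFlat n f) : ∃ g : ℂ → ℂ, ContDiff ℝ ∞ g ∧ ∀ z, f z = z * g z := by
  have key : ∀ k : ℕ, ∃ g : ℂ → ℂ, ContDiff ℝ k g ∧ ∀ z, f z = z * g z := by
    intro k
    obtain ⟨a, b, ha, hb, -, h⟩ := exists_eq_mul_add_conj_pow_mul hf hflat (k + 2)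
    have h1 := contDiff_conj_pow_div_pow k (k + 2) 1 (by omega)
    have ha' : ContDiff ℝ k a := ha.of_le (by exact_mod_cast le_top)
    have hb' : ContDiff ℝ k b := hb.of_le (by exact_mod_cast le_top)
    refine ⟨fun z => a z + (starRingEnd ℂ) z ^ (k + 2) / z ^ 1 * b z, by fun_prop, fun z => ?_⟩
    rw [h]
    rcases eq_or_ne z 0 with rfl | hz
    · simp
    · field_simp
  obtain ⟨g, hg, hfg⟩ := key 0
  refine ⟨g, contDiff_infty.2 fun k => ?_, hfg⟩
  obtain ⟨g', hg', hfg'⟩ := key k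
  have : g = g' := by
    refine Continuous.ext_on (dense_compl_singleton (0 : ℂ)) hg.continuous hg'.continuous ?_
    intro z hz
    exact mul_left_cancel₀ hz ((hfg z).symm.trans (hfg' z))
  rwa [this]

/-! ### Zeros of solutions of the first-order system -/

/-- Smooth solutions of the system `Dbar u₁ = a u₂`, `Dbar u₂ = b u₁`. -/
structure IsSol (a b : ℂ → ℂ) (u : ℂ → ℂ × ℂ) : Prop where
  contDiff : ContDiff ℝ ∞ u
  fst : ∀ z, Dbar (fun w => (u w).1) z = a z * (u z).2
  snd : ∀ z, Dbar (fun w => (u w).2) z = b z * (u z).1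

lemma DbarFlat.of_system {a b f g : ℂ → ℂ} (ha : ContDiff ℝ ∞ a) (hb : ContDiff ℝ ∞ b)
    (hf : ContDiff ℝ ∞ f) (hg : ContDiff ℝ ∞ g) (hfg : ∀ z, Dbar f z = a z * g z)
    (hgf : ∀ z, Dbar g z = b z * f z) (hf0 : f 0 = 0) (hg0 : g 0 = 0) (n : ℕ) :
    DbarFlat n f ∧ DbarFlat n g := by
  induction n with
  | zero => exact ⟨hf0, hg0⟩
  | succ n ih =>
    refine ⟨⟨hf0, ?_⟩, ⟨hg0, ?_⟩⟩
    · rw [funext hfg]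
      exact ih.2.mul_left ha hg
    · rw [funext hgf]
      exact ih.1.mul_left hb hf

lemma Dbar_eq_of_id_mul {a f g F G : ℂ → ℂ} (ha : Continuous a) (hF : ContDiff ℝ ∞ F)
    (hG : Continuous G) (hf : ∀ z, f z = z * F z) (hg : ∀ z, g z = z * G z)
    (h : ∀ z, Dbar f z = a z * g z) (z : ℂ) : Dbar F z = a z * G z := by
  have hc : Continuous (Dbar F) := (contDiff_Dbar hF).continuous
  refine congrFun (Continuous.ext_on (dense_compl_singleton (0 : ℂ)) hc (ha.mul hG) ?_) z
  intro z hz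
  have h1 : Dbar f z = z * Dbar F z := by
    rw [funext hf, Dbar_mul differentiableAt_fun_id (hF.differentiable (by simp) z),
      Dbar_of_differentiableAt differentiableAt_fun_id, zero_mul, add_zero]
  refine mul_left_cancel₀ (show z ≠ 0 from hz) ?_
  rw [← h1, h, hg, Pi.mul_apply]
  ring

lemma IsSol.exists_div_zero {a b : ℂ → ℂ} {u : ℂ → ℂ × ℂ} (hu : IsSol a b u)
    (ha : ContDiff ℝ ∞ a) (hb : ContDiff ℝ ∞ b) (h0 : u 0 = 0) :
    ∃ w, IsSol a b w ∧ ∀ z, u z = z • w z := by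
  have hs := hu.contDiff
  have h1 : ContDiff ℝ ∞ fun z => (u z).1 := by fun_prop
  have h2 : ContDiff ℝ ∞ fun z => (u z).2 := by fun_prop
  have hflat := DbarFlat.of_system ha hb h1 h2 hu.fst hu.snd (by simp [h0]) (by simp [h0])
  obtain ⟨F, hF, hFu⟩ := exists_eq_mul_of_DbarFlat h1 fun n => (hflat n).1
  obtain ⟨G, hG, hGu⟩ := exists_eq_mul_of_DbarFlat h2 fun n => (hflat n).2
  exact ⟨fun z => (F z, G z),
    ⟨hF.prodMk hG, Dbar_eq_of_id_mul ha.continuous hF hG.continuous hFu hGu hu.fst,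
      Dbar_eq_of_id_mul hb.continuous hG hF.continuous hGu hFu hu.snd⟩,
    fun z => Prod.ext (hFu z) (hGu z)⟩

lemma IsSol.comp_add_left {a b : ℂ → ℂ} {u : ℂ → ℂ × ℂ} (hu : IsSol a b u) (p : ℂ) :
    IsSol (fun z => a (p + z)) (fun z => b (p + z)) (fun z => u (p + z)) where
  contDiff := by
    have := hu.contDiff
    fun_prop
  fst z := (Dbar_comp_add_left (fun w => (u w).1) p z).trans (hu.fst _)
  snd z := (Dbar_comp_add_left (fun w => (u w).2) p z).trans (hu.snd _)

/-- A solution vanishing at `p` is divisible by `z - p`, and the quotient is a solution. -/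
lemma IsSol.exists_div {a b : ℂ → ℂ} {u : ℂ → ℂ × ℂ} (hu : IsSol a b u)
    (ha : ContDiff ℝ ∞ a) (hb : ContDiff ℝ ∞ b) {p : ℂ} (hp : u p = 0) :
    ∃ w, IsSol a b w ∧ ∀ z, u z = (z - p) • w z := by
  obtain ⟨w, hw, huw⟩ := (hu.comp_add_left p).exists_div_zero (by fun_prop) (by fun_prop)
    (by simpa using hp)
  refine ⟨fun z => w (-p + z), ?_, fun z => ?_⟩
  · simpa using hw.comp_add_left (-p)
  · simpa [sub_eq_neg_add] using huw (-p + z)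

/-! ### Multiplying kernel elements by meromorphic functions -/

lemma exists_contDiff_of_eventuallyEq {F : ℂ → ℂ × ℂ}
    (h : ∀ p, ∃ G, ContDiffAt ℝ ∞ G p ∧ F =ᶠ[𝓝[≠] p] G) :
    ∃ v, ContDiff ℝ ∞ v ∧ ∀ p, v =ᶠ[𝓝[≠] p] F := by
  choose G hG hFG using h
  have hev : ∀ p, (fun z => G z z) =ᶠ[𝓝[≠] p] G p := fun p => by
    have hcont : ∀ᶠ q in 𝓝[≠] p, ContinuousAt (G p) q :=
      ((((hG p).of_le (m := 1) (by exact_mod_cast le_top)).eventually (by simp)).mono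
        fun q hq => hq.continuousAt).filter_mono nhdsWithin_le_nhds
    filter_upwards [hcont, eventually_nhdsNE_eventually_nhds_iff.2 (hFG p)] with q hq hF
    have : G q =ᶠ[𝓝[≠] q] G p := by
      filter_upwards [hFG q, hF.filter_mono nhdsWithin_le_nhds] with z h1 h2
      rw [← h1, h2]
    exact (((hG q).continuousAt.eventuallyEq_nhds_iff_eventuallyEq_nhdsNE hq).1 this).eq_of_nhds
  refine ⟨fun z => G z z, contDiff_iff_contDiffAt.2 fun p => ?_,
    fun p => (hev p).trans (hFG p).symm⟩
  refine (hG p).congr_of_eventuallyEq ?_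
  filter_upwards [eventually_nhdsWithin_iff.1 (hev p)] with z hz
  rcases eq_or_ne z p with rfl | hne
  · rfl
  · exact hz hne

/-- `u` is divisible by `(z - p) ^ m` with smooth quotient. -/
def VanishesToOrder (u : ℂ → ℂ × ℂ) (p : ℂ) (m : ℕ) : Prop :=
  ∃ w : ℂ → ℂ × ℂ, ContDiff ℝ ∞ w ∧ ∀ z, u z = (z - p) ^ m • w z

lemma eq_of_eventuallyEq_nhdsNE {E : Type} [TopologicalSpace E] [T2Space E] {f g : ℂ → E}
    {p : ℂ} (hf : ContinuousAt f p) (hg : ContinuousAt g p) (h : f =ᶠ[𝓝[≠] p] g) : f p = g p :=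
  ((hf.eventuallyEq_nhds_iff_eventuallyEq_nhdsNE hg).1 h).eq_of_nhds

lemma tendsto_add_right_nhdsNE (p γ : ℂ) :
    Tendsto (fun z => z + γ) (𝓝[≠] p) (𝓝[≠] (p + γ)) :=
  tendsto_nhdsWithin_of_tendsto_nhds_of_eventually_within _
    ((by fun_prop : Continuous fun z : ℂ => z + γ).continuousAt.mono_left nhdsWithin_le_nhds)
    (by filter_upwards [self_mem_nhdsWithin] with z hz; simpa using hz)

lemma tendsto_mul_left_nhdsNE {c : ℂ} (hc : c ≠ 0) (p : ℂ) :
    Tendsto (fun z => c * z) (𝓝[≠] p) (𝓝[≠] (c * p)) :=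
  tendsto_nhdsWithin_of_tendsto_nhds_of_eventually_within _
    ((by fun_prop : Continuous fun z : ℂ => c * z).continuousAt.mono_left nhdsWithin_le_nhds)
    (by filter_upwards [self_mem_nhdsWithin] with z hz; simpa [hc] using hz)

lemma exists_contDiff_eq_smul {u : ℂ → ℂ × ℂ} {h : ℂ → ℂ} (hh : Meromorphic h)
    (hord : ∀ p, ∃ m : ℕ, VanishesToOrder u p m ∧ ((-m : ℤ) : WithTop ℤ) ≤ meromorphicOrderAt h p) :
    ∃ v, ContDiff ℝ ∞ v ∧ ∀ p, v =ᶠ[𝓝[≠] p] fun z => h z • u z := by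
  refine exists_contDiff_of_eventuallyEq fun p => ?_
  obtain ⟨m, ⟨w, hw, huw⟩, hm⟩ := hord p
  have hid : AnalyticAt ℂ (fun z : ℂ => z - p) p := by fun_prop
  set g : ℂ → ℂ := (fun z => z - p) ^ m * h with hg
  have hmer : MeromorphicAt g p := (hid.meromorphicAt.pow m).mul (hh p)
  have hgord : 0 ≤ meromorphicOrderAt g p := by
    have h1 : meromorphicOrderAt (fun z : ℂ => z - p) p = (1 : ℤ) :=
      (meromorphicOrderAt_eq_int_iff hid.meromorphicAt).2
        ⟨fun _ => 1, by fun_prop, one_ne_zero, by simp⟩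
    rw [hg, meromorphicOrderAt_mul (hid.meromorphicAt.pow m) (hh p),
      meromorphicOrderAt_pow hid.meromorphicAt, h1]
    calc (0 : WithTop ℤ) = ((m : ℤ) : WithTop ℤ) + ((-m : ℤ) : WithTop ℤ) := by
          rw [← WithTop.coe_add]; simp
      _ ≤ _ := by
          refine add_le_add (le_of_eq ?_) hm
          simp
  have hana : AnalyticAt ℂ (toMeromorphicNFAt g p) p := by
    rw [← meromorphicNFAt_toMeromorphicNFAt.meromorphicOrderAt_nonneg_iff_analyticAt,
      ← meromorphicOrderAt_congr hmer.eq_nhdsNE_toMeromorphicNFAt]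
    exact hgord
  refine ⟨fun z => toMeromorphicNFAt g p z • w z, ?_, ?_⟩
  · exact hana.restrictScalars.contDiffAt.smul hw.contDiffAt
  · filter_upwards [hmer.eq_nhdsNE_toMeromorphicNFAt] with z hz
    rw [huw, ← hz, hg, smul_smul, Pi.mul_apply, Pi.pow_apply, mul_comm]

lemma Dbar_congr {f g : ℂ → ℂ} {z : ℂ} (h : f =ᶠ[𝓝 z] g) : Dbar f z = Dbar g z := by
  simp only [Dbar, h.fderiv_eq]

/-- If the poles of the `Λ`-periodic meromorphic function `h` are compensated by the zeros of
the kernel element `u`, then `h • u` extends to a kernel element. -/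
lemma InKer.exists_eq_smul {Up Um : ℂ → ℂ} {α : ℂ} {u : ℂ → ℂ × ℂ} {h : ℂ → ℂ}
    (hUp : Continuous Up) (hUm : Continuous Um) (hu : InKer Up Um α 0 u) (hh : Meromorphic h)
    (hper : ∀ γ ∈ Λ, ∀ z, h (z + γ) = h z)
    (hord : ∀ p, ∃ m : ℕ, VanishesToOrder u p m ∧ ((-m : ℤ) : WithTop ℤ) ≤ meromorphicOrderAt h p) :
    ∃ v, InKer Up Um α 0 v ∧ ∀ p, v =ᶠ[𝓝[≠] p] fun z => h z • u z := by
  obtain ⟨v, hv, hvu⟩ := exists_contDiff_eq_smul hh hord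
  obtain ⟨hus, hu1, hu2, hu3, hu4⟩ := hu
  have hv1 : ContDiff ℝ ∞ fun z => (v z).1 := by fun_prop
  have hv2 : ContDiff ℝ ∞ fun z => (v z).2 := by fun_prop
  have hus1 : ContDiff ℝ ∞ fun z => (u z).1 := by fun_prop
  have hus2 : ContDiff ℝ ∞ fun z => (u z).2 := by fun_prop
  have hc1 := (contDiff_Dbar hv1).continuous
  have hc2 := (contDiff_Dbar hv2).continuous
  have hvc := hv.continuous
  have key : ∀ p, ∀ᶠ z in 𝓝[≠] p, AnalyticAt ℂ h z ∧ v =ᶠ[𝓝 z] fun z => h z • u z := fun p => by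
    filter_upwards [(hh p).eventually_analyticAt,
      eventually_nhdsNE_eventually_nhds_iff.2 (hvu p)] with z h1 h2 using ⟨h1, h2⟩
  refine ⟨v, ⟨hv, fun p => ?_, fun p => ?_, fun γ hγ p => ?_, fun γ hγ p => ?_⟩, hvu⟩
  · refine eq_of_eventuallyEq_nhdsNE (g := fun _ => (0 : ℂ))
      (f := fun z => Dbar (fun w => (v w).1) z + 0 * (v z).1 + α * Up z * (v z).2)
      (by fun_prop) (by fun_prop) ?_
    filter_upwards [key p] with z ⟨hz, hvz⟩
    have h1 : Dbar (fun w => (v w).1) z = h z * Dbar (fun w => (u w).1) z := by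
      rw [Dbar_congr (g := fun w => h w * (u w).1) (hvz.mono fun w hw => by simp [hw]),
        Dbar_mul (hz.differentiableAt.restrictScalars ℝ) (hus1.differentiable (by simp) z),
        Dbar_of_differentiableAt hz.differentiableAt]
      simp
    rw [h1, hvz.eq_of_nhds]
    simp only [Prod.smul_fst, Prod.smul_snd, smul_eq_mul]
    linear_combination h z * hu1 z
  · refine eq_of_eventuallyEq_nhdsNE (g := fun _ => (0 : ℂ))
      (f := fun z => Dbar (fun w => (v w).2) z + 0 * (v z).2 + α * Um z * (v z).1)
      (by fun_prop) (by fun_prop) ?_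
    filter_upwards [key p] with z ⟨hz, hvz⟩
    have h1 : Dbar (fun w => (v w).2) z = h z * Dbar (fun w => (u w).2) z := by
      rw [Dbar_congr (g := fun w => h w * (u w).2) (hvz.mono fun w hw => by simp [hw]),
        Dbar_mul (hz.differentiableAt.restrictScalars ℝ) (hus2.differentiable (by simp) z),
        Dbar_of_differentiableAt hz.differentiableAt]
      simp
    rw [h1, hvz.eq_of_nhds]
    simp only [Prod.smul_fst, Prod.smul_snd, smul_eq_mul]
    linear_combination h z * hu2 z
  · refine eq_of_eventuallyEq_nhdsNE (f := fun z => (v (z + γ)).1)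
      (g := fun z => exp (-I * (pair γ K : ℂ)) * (v z).1) (by fun_prop) (by fun_prop) ?_
    filter_upwards [(tendsto_add_right_nhdsNE p γ).eventually (hvu (p + γ)), hvu p] with z h1 h2
    rw [h1, h2, hper γ hγ]
    simp only [Prod.smul_fst, smul_eq_mul, hu3 γ hγ]
    ring
  · refine eq_of_eventuallyEq_nhdsNE (f := fun z => (v (z + γ)).2)
      (g := fun z => exp (I * (pair γ K : ℂ)) * (v z).2) (by fun_prop) (by fun_prop) ?_
    filter_upwards [(tendsto_add_right_nhdsNE p γ).eventually (hvu (p + γ)), hvu p] with z h1 h2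
    rw [h1, h2, hper γ hγ]
    simp only [Prod.smul_snd, smul_eq_mul, hu4 γ hγ]
    ring

lemma rotation_of_eventuallyEq_smul {u v : ℂ → ℂ × ℂ} {h : ℂ → ℂ} {ρ c d : ℂ} (hρ : ρ ≠ 0)
    (hv : Continuous v) (hvu : ∀ p, v =ᶠ[𝓝[≠] p] fun z => h z • u z)
    (hh : ∀ z, h (ρ * z) = c * h z) (hu : ∀ z, u (ρ * z) = d • u z) (z : ℂ) :
    v (ρ * z) = (c * d) • v z := by
  refine eq_of_eventuallyEq_nhdsNE (f := fun z => v (ρ * z)) (g := fun z => (c * d) • v z)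
    (by fun_prop) (by fun_prop) ?_
  filter_upwards [(tendsto_mul_left_nhdsNE hρ z).eventually (hvu (ρ * z)), hvu z] with w h1 h2
  rw [h1, h2, hh, hu, smul_smul, smul_smul]
  congr 1
  ring

lemma ne_zero_of_eventuallyEq_smul {u v : ℂ → ℂ × ℂ} {h : ℂ → ℂ} (hu : Continuous u)
    (hu0 : u ≠ 0) (hh : Meromorphic h) (htop : ∀ p, meromorphicOrderAt h p ≠ ⊤)
    (hvu : ∀ p, v =ᶠ[𝓝[≠] p] fun z => h z • u z) : v ≠ 0 := by
  rintro rfl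
  refine hu0 (funext fun p => eq_of_eventuallyEq_nhdsNE hu.continuousAt
    (g := fun _ => 0) continuousAt_const ?_)
  filter_upwards [hvu p, (meromorphicOrderAt_ne_top_iff_eventually_ne_zero (hh p)).1 (htop p)]
    with z h1 h2
  exact (smul_eq_zero.1 h1.symm).resolve_left h2

lemma InKer.isSol {Up Um : ℂ → ℂ} {α : ℂ} {u : ℂ → ℂ × ℂ} (hu : InKer Up Um α 0 u) :
    IsSol (fun z => -(α * Up z)) (fun z => -(α * Um z)) u :=
  ⟨hu.1, fun z => by linear_combination hu.2.1 z, fun z => by linear_combination hu.2.2.1 z⟩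

lemma InKer.vanishesToOrder_add {Up Um : ℂ → ℂ} {α : ℂ} {u : ℂ → ℂ × ℂ}
    (hu : InKer Up Um α 0 u) {p : ℂ} {m : ℕ} (h : VanishesToOrder u p m) {γ : ℂ} (hγ : γ ∈ Λ) :
    VanishesToOrder u (p + γ) m := by
  obtain ⟨w, hw, huw⟩ := h
  refine ⟨fun z => (exp (-I * (pair γ K : ℂ)) * (w (z - γ)).1,
    exp (I * (pair γ K : ℂ)) * (w (z - γ)).2), by fun_prop, fun z => ?_⟩
  have e1 := hu.2.2.2.1 γ hγ (z - γ)
  have e2 := hu.2.2.2.2 γ hγ (z - γ)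
  rw [sub_add_cancel, huw (z - γ)] at e1 e2
  ext
  · rw [e1]; simp only [Prod.smul_mk, Prod.smul_fst, smul_eq_mul]; ring
  · rw [e2]; simp only [Prod.smul_mk, Prod.smul_snd, smul_eq_mul]; ring

lemma VanishesToOrder.zero {u : ℂ → ℂ × ℂ} (hu : ContDiff ℝ ∞ u) (p : ℂ) :
    VanishesToOrder u p 0 := ⟨u, hu, by simp⟩

end

open scoped Topology
open Filter

/-! ### The lattice `Λ` and its Weierstrass function -/

lemma omega_eq : ω = -1 / 2 + (Real.sqrt 3 / 2 : ℝ) * I := by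
  have h1 : 2 * Real.pi / 3 = Real.pi - Real.pi / 3 := by ring
  have h : ω = exp ((2 * Real.pi / 3 : ℝ) * I) := by
    rw [ω]; congr 1; push_cast; ring
  rw [h, exp_mul_I, ← ofReal_cos, ← ofReal_sin, h1, Real.cos_pi_sub, Real.sin_pi_sub,
    Real.cos_pi_div_three, Real.sin_pi_div_three]
  push_cast
  ring

lemma omega_re : ω.re = -1 / 2 := by
  rw [omega_eq]; norm_num

lemma omega_im : ω.im = Real.sqrt 3 / 2 := by
  rw [omega_eq]; norm_num

lemma omega_sq : ω ^ 2 = -1 - ω := by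
  have h3 : ((Real.sqrt 3 : ℝ) : ℂ) ^ 2 = 3 := by
    rw [← ofReal_pow, Real.sq_sqrt (by norm_num)]; norm_num
  rw [omega_eq]
  push_cast
  linear_combination (3 / 4) * I_sq + (1 / 4 * I ^ 2) * h3

lemma omega_cube : ω ^ 3 = 1 := by
  linear_combination (ω - 1) * omega_sq

lemma omega_ne_zero : ω ≠ 0 := exp_ne_zero _

lemma omega_ne_one : ω ≠ 1 := fun h => by
  have := omega_re
  rw [h] at this
  norm_num at this

lemma omega_sq_ne_one : ω ^ 2 ≠ 1 := fun h => omega_ne_one <| by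
  linear_combination omega_cube - ω * h

lemma omega_sq_ne_omega : ω ^ 2 ≠ ω := fun h => omega_ne_one <| by
  linear_combination omega_cube - (ω + 1) * h

/-- The periods `ω` and `1` of `Λ`. -/
def periods : PeriodPair where
  ω₁ := ω
  ω₂ := 1
  indep := by
    rw [LinearIndependent.pair_iff]
    intro a b hab
    have him := congrArg Complex.im hab
    have hre := congrArg Complex.re hab
    simp [omega_im, omega_re] at him hre
    subst him
    exact ⟨rfl, by simpa using hre⟩

lemma mem_lattice_iff {z : ℂ} : z ∈ periods.lattice ↔ z ∈ Λ := by
  rw [PeriodPair.mem_lattice]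
  simp only [periods, Λ, mul_one, Set.mem_ofPred_eq, eq_comm]

lemma omega_mul_mem {z : ℂ} (hz : z ∈ Λ) : ω * z ∈ Λ := by
  obtain ⟨m, n, rfl⟩ := hz
  refine ⟨n - m, -m, ?_⟩
  push_cast
  linear_combination (m : ℂ) * omega_sq

lemma add_mem_Λ {z w : ℂ} (hz : z ∈ Λ) (hw : w ∈ Λ) : z + w ∈ Λ :=
  mem_lattice_iff.1 (add_mem (mem_lattice_iff.2 hz) (mem_lattice_iff.2 hw))

lemma neg_mem_Λ {z : ℂ} (hz : z ∈ Λ) : -z ∈ Λ :=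
  mem_lattice_iff.1 (neg_mem (mem_lattice_iff.2 hz))

/-- The Weierstrass function of `Λ`. -/
def wp (z : ℂ) : ℂ := periods.weierstrassP z

lemma wp_add {γ : ℂ} (hγ : γ ∈ Λ) (z : ℂ) : wp (z + γ) = wp z :=
  periods.weierstrassP_add_coe z ⟨γ, mem_lattice_iff.2 hγ⟩

lemma wp_neg (z : ℂ) : wp (-z) = wp z := periods.weierstrassP_neg z

/-- Multiplication by `ω` on `Λ`. -/
def latticeRotation : periods.lattice ≃ periods.lattice where
  toFun l := ⟨ω * l, mem_lattice_iff.2 (omega_mul_mem (mem_lattice_iff.1 l.2))⟩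
  invFun l := ⟨ω * (ω * l),
    mem_lattice_iff.2 (omega_mul_mem (omega_mul_mem (mem_lattice_iff.1 l.2)))⟩
  left_inv l := Subtype.ext (by linear_combination (l : ℂ) * omega_cube)
  right_inv l := Subtype.ext (by linear_combination (l : ℂ) * omega_cube)

lemma wp_omega_mul (z : ℂ) : wp (ω * z) = ω * wp z := by
  have hinv : (ω ^ 2)⁻¹ = ω := by
    rw [inv_eq_iff_eq_inv]
    exact eq_inv_of_mul_eq_one_left (by linear_combination omega_cube)
  rw [wp, wp, PeriodPair.weierstrassP, PeriodPair.weierstrassP, ← tsum_mul_left,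
    ← latticeRotation.tsum_eq]
  refine tsum_congr fun l => ?_
  change 1 / (ω * z - ω * l) ^ 2 - 1 / (ω * (l : ℂ)) ^ 2 = _
  rw [← mul_sub, mul_pow, mul_pow, one_div, one_div, mul_inv, mul_inv, hinv]
  ring

lemma meromorphic_wp_sub (a : ℂ) : Meromorphic fun z => wp (z - a) := fun p =>
  (periods.meromorphic_weierstrassP (p - a)).comp_analyticAt (g := fun z => z - a) (by fun_prop)

lemma analyticAt_wp_sub {a p : ℂ} (h : p - a ∉ Λ) : AnalyticAt ℂ (fun z => wp (z - a)) p :=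
  (periods.analyticOnNhd_weierstrassP (p - a) fun h' => h (mem_lattice_iff.1 h')).fun_comp
    (g := periods.weierstrassP) (f := fun z => z - a) (by fun_prop)

lemma order_wp_sub {a p : ℂ} (h : p - a ∈ Λ) :
    meromorphicOrderAt (fun z => wp (z - a)) p = (-2 : ℤ) := by
  have := meromorphicOrderAt_comp_of_deriv_ne_zero (f := wp) (g := fun z => z - a) (x := p)
    (by fun_prop) (by simp)
  exact this.trans (periods.order_weierstrassP _ (mem_lattice_iff.2 h))

lemma order_wp_sub_ne_top (a p : ℂ) : meromorphicOrderAt (fun z => wp (z - a)) p ≠ ⊤ := by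
  refine (meromorphic_wp_sub a).exists_meromorphicOrderAt_ne_top_iff_forall.1 ⟨a, ?_⟩ p
  rw [order_wp_sub (by simpa using ⟨0, 0, by simp⟩)]
  exact WithTop.coe_ne_top

/-- A point of `ℂ` whose class modulo `Λ` is fixed by multiplication by `ω`. -/
def zS : ℂ := (1 + 2 * ω) / 3

lemma omega_mul_zS : ω * zS = zS + (-1 - ω) := by
  rw [zS]
  linear_combination (2 / 3) * omega_sq

lemma neg_one_sub_omega_mem : -1 - ω ∈ Λ := ⟨-1, -1, by push_cast; ring⟩

lemma three_mul_zS_mem : 3 * zS ∈ Λ := ⟨2, 1, by rw [zS]; push_cast; ring⟩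

lemma zS_notMem : zS ∉ Λ := fun h => by
  have h1 : ((2 / 3 : ℚ) : ℂ) * periods.ω₁ + ((1 / 3 : ℚ) : ℂ) * periods.ω₂ ∈ periods.lattice := by
    convert mem_lattice_iff.2 h using 1
    simp only [periods, zS]
    push_cast
    ring
  have h2 := (PeriodPair.mul_ω₁_add_mul_ω₂_mem_lattice.1 h1).1
  norm_num at h2

lemma two_mul_zS_notMem : 2 * zS ∉ Λ := fun h => zS_notMem <| by
  have := add_mem_Λ three_mul_zS_mem (neg_mem_Λ h)
  convert this using 1
  ring

lemma wp_zS : wp zS = 0 := by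
  have h := wp_omega_mul zS
  rw [omega_mul_zS, wp_add neg_one_sub_omega_mem] at h
  have h' : (ω - 1) * wp zS = 0 := by linear_combination -h
  exact (mul_eq_zero.1 h').resolve_left (sub_ne_zero.2 omega_ne_one)

lemma wp_two_mul_zS : wp (2 * zS) = 0 := by
  rw [show 2 * zS = -zS + 3 * zS by ring, wp_add three_mul_zS_mem, wp_neg, wp_zS]

lemma wp_omega_mul_sub_zS (z : ℂ) : wp (ω * z - zS) = ω * wp (z - zS) := by
  rw [← wp_omega_mul, ← wp_add neg_one_sub_omega_mem (ω * (z - zS)), mul_sub, omega_mul_zS]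
  congr 1
  ring

lemma wp_omega_mul_add_zS (z : ℂ) : wp (ω * z + zS) = ω * wp (z + zS) := by
  rw [← wp_neg, ← wp_neg (z + zS), show -(z + zS) = -z - zS by ring, ← wp_omega_mul_sub_zS]
  congr 1
  ring

/-- The product of the translates of `wp` with poles at `zS` and `-zS`; the double poles are
partially cancelled, so that its poles are simple. -/
def wpProd (z : ℂ) : ℂ := wp (z - zS) * wp (z - -zS)

lemma meromorphic_wpProd : Meromorphic wpProd := fun p =>
  (meromorphic_wp_sub zS p).mul (meromorphic_wp_sub (-zS) p)

lemma order_wpProd (p : ℂ) : meromorphicOrderAt wpProd p =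
    meromorphicOrderAt (fun z => wp (z - zS)) p + meromorphicOrderAt (fun z => wp (z - -zS)) p :=
  meromorphicOrderAt_mul (meromorphic_wp_sub zS p) (meromorphic_wp_sub (-zS) p)

lemma order_wpProd_ne_top (p : ℂ) : meromorphicOrderAt wpProd p ≠ ⊤ := by
  rw [order_wpProd]
  exact WithTop.add_ne_top.2 ⟨order_wp_sub_ne_top _ _, order_wp_sub_ne_top _ _⟩

lemma wpProd_omega_mul (z : ℂ) : wpProd (ω * z) = ω ^ 2 * wpProd z := by
  rw [wpProd, wpProd, sub_neg_eq_add, sub_neg_eq_add, wp_omega_mul_sub_zS, wp_omega_mul_add_zS]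
  ring

lemma one_le_order_of_eq_zero {f : ℂ → ℂ} {p : ℂ} (hf : AnalyticAt ℂ f p) (h0 : f p = 0) :
    ((1 : ℤ) : WithTop ℤ) ≤ meromorphicOrderAt f p := by
  have h : analyticOrderAt f p ≠ 0 := hf.analyticOrderAt_ne_zero.2 h0
  rw [hf.meromorphicOrderAt_eq]
  cases hn : analyticOrderAt f p with
  | top => simp
  | coe n =>
    rw [hn] at h
    rw [ENat.map_natCast]
    exact_mod_cast Nat.one_le_iff_ne_zero.2 (by exact_mod_cast h)

lemma neg_one_le_order_wpProd (p : ℂ) : ((-1 : ℤ) : WithTop ℤ) ≤ meromorphicOrderAt wpProd p := by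
  have key : ((-1 : ℤ) : WithTop ℤ) = ((-2 : ℤ) : WithTop ℤ) + ((1 : ℤ) : WithTop ℤ) := by
    rw [← WithTop.coe_add]; norm_num
  rw [order_wpProd]
  by_cases h1 : p - zS ∈ Λ
  · have e : p - -zS = 2 * zS + (p - zS) := by ring
    have h2 : p - -zS ∉ Λ := fun h2 => two_mul_zS_notMem <| by
      convert add_mem_Λ h2 (neg_mem_Λ h1) using 1
      ring
    rw [order_wp_sub h1, key]
    gcongr
    exact one_le_order_of_eq_zero (analyticAt_wp_sub h2) (by rw [e, wp_add h1, wp_two_mul_zS])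
  · by_cases h2 : p - -zS ∈ Λ
    · have e : p - zS = -(2 * zS) + (p - -zS) := by ring
      rw [order_wp_sub h2, key, add_comm]
      gcongr
      exact one_le_order_of_eq_zero (analyticAt_wp_sub h1)
        (by rw [e, wp_add h2, wp_neg, wp_two_mul_zS])
    · refine le_trans ?_ (add_nonneg (analyticAt_wp_sub h1).meromorphicOrderAt_nonneg
        (analyticAt_wp_sub h2).meromorphicOrderAt_nonneg)
      exact_mod_cast (by norm_num : (-1 : ℤ) ≤ 0)

lemma order_wpProd_nonneg {p : ℂ} (h1 : p - zS ∉ Λ) (h2 : p + zS ∉ Λ) :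
    0 ≤ meromorphicOrderAt wpProd p := by
  rw [order_wpProd]
  exact add_nonneg (analyticAt_wp_sub h1).meromorphicOrderAt_nonneg
    (analyticAt_wp_sub (by simpa using h2)).meromorphicOrderAt_nonneg

/-! ### Rotation and translation of kernel elements -/

lemma pair_K (z : ℂ) : pair z K = z.re * (4 * Real.pi / 3) := by
  have h : K = ((4 * Real.pi / 3 : ℝ) : ℂ) := by rw [K]; push_cast; rfl
  rw [pair, h, conj_ofReal, re_mul_ofReal]

lemma exp_neg_pair_eq : exp (-I * (pair (-1 - ω) K : ℂ)) = ω := by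
  rw [pair_K, ω]
  congr 1
  rw [sub_re, neg_re, one_re, ← ω, omega_re]
  push_cast
  ring

lemma exp_pair_eq : exp (I * (pair (-1 - ω) K : ℂ)) = ω ^ 2 := by
  have h : exp (I * (pair (-1 - ω) K : ℂ)) * ω = 1 := by
    nth_rw 2 [← exp_neg_pair_eq]
    rw [← exp_add]
    simp
  linear_combination ω ^ 2 * h - exp (I * (pair (-1 - ω) K : ℂ)) * omega_cube

lemma exp_pair_omega_mul {γ : ℂ} (hγ : γ ∈ Λ) :
    exp (I * (pair (ω * γ) K : ℂ)) = exp (I * (pair γ K : ℂ)) := by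
  obtain ⟨m, n, rfl⟩ := hγ
  rw [exp_eq_exp_iff_exists_int]
  refine ⟨-n, ?_⟩
  have h : ω * (m * ω + n) = (n - m) * ω - m := by linear_combination (m : ℂ) * omega_sq
  rw [h, pair_K, pair_K]
  have h1 : ((n - m) * ω - m : ℂ).re = -(m + n) / 2 := by
    simp [omega_re]; ring
  have h2 : (m * ω + n : ℂ).re = n - m / 2 := by
    simp [omega_re]; ring
  rw [h1, h2]
  push_cast
  ring

lemma exp_neg_pair_omega_mul {γ : ℂ} (hγ : γ ∈ Λ) :
    exp (-I * (pair (ω * γ) K : ℂ)) = exp (-I * (pair γ K : ℂ)) := by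
  rw [neg_mul, neg_mul, exp_neg, exp_neg, exp_pair_omega_mul hγ]

lemma Dbar_comp_mul_left {f : ℂ → ℂ} (hf : Differentiable ℝ f) (c z : ℂ) :
    Dbar (fun w => f (c * w)) z = (starRingEnd ℂ) c * Dbar f (c * z) := by
  have h1 : HasFDerivAt (fun w : ℂ => c * w) (c • (1 : ℂ →L[ℝ] ℂ)) z :=
    (hasFDerivAt_id (𝕜 := ℝ) z).const_mul c
  have h2 : HasFDerivAt (fun w => f (c * w)) _ z := (hf (c * z)).hasFDerivAt.comp z h1
  have hlin : ∀ x : ℂ, fderiv ℝ f (c * z) x =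
      x.re * fderiv ℝ f (c * z) 1 + x.im * fderiv ℝ f (c * z) I := fun x => by
    have hx : x = x.re • (1 : ℂ) + x.im • I := by simp
    conv_lhs => rw [hx, map_add, map_smul, map_smul]
    simp
  have hconj : (starRingEnd ℂ) c = c.re - c.im * I := by
    apply Complex.ext <;> simp
  rw [Dbar, Dbar, h2.fderiv, hconj]
  simp only [ContinuousLinearMap.comp_apply, smul_apply, one_apply_eq_self,
    smul_eq_mul, mul_one]
  rw [hlin c, hlin (c * I)]
  simp only [mul_re, mul_im, I_re, I_im]
  push_cast
  linear_combination (1 / I) * c.im * fderiv ℝ f (c * z) I * I_sq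

lemma conj_omega_mul : (starRingEnd ℂ) ω * ω = 1 := by
  have h : (starRingEnd ℂ) ω = ω ^ 2 := by
    rw [omega_sq]
    apply Complex.ext
    · simp [omega_re]; norm_num
    · simp
  rw [h]
  linear_combination omega_cube

lemma InKer.rotate {U : ℂ → ℂ} {α : ℂ} {u : ℂ → ℂ × ℂ} (hU : ∀ z, U (ω * z) = ω * U z)
    (hu : InKer U (fun z => U (-z)) α 0 u) :
    InKer U (fun z => U (-z)) α 0 fun z => u (ω * z) := by
  obtain ⟨hs, h1, h2, h3, h4⟩ := hu
  have hs1 : ContDiff ℝ (⊤ : ℕ∞) fun z => (u z).1 := by fun_prop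
  have hs2 : ContDiff ℝ (⊤ : ℕ∞) fun z => (u z).2 := by fun_prop
  refine ⟨by fun_prop, fun z => ?_, fun z => ?_, fun γ hγ z => ?_, fun γ hγ z => ?_⟩
  · have e := h1 (ω * z)
    rw [hU] at e
    rw [Dbar_comp_mul_left (f := fun w => (u w).1) (hs1.differentiable (by simp))]
    linear_combination (starRingEnd ℂ) ω * e - α * U z * (u (ω * z)).2 * conj_omega_mul
  · have e := h2 (ω * z)
    simp only [← mul_neg, hU] at e
    rw [Dbar_comp_mul_left (f := fun w => (u w).2) (hs2.differentiable (by simp))]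
    linear_combination (starRingEnd ℂ) ω * e - α * U (-z) * (u (ω * z)).1 * conj_omega_mul
  · simp only [mul_add, h3 _ (omega_mul_mem hγ), exp_neg_pair_omega_mul hγ]
  · simp only [mul_add, h4 _ (omega_mul_mem hγ), exp_pair_omega_mul hγ]

/-- `Ker(α,0)` as a subspace. -/
def kerSub (Up Um : ℂ → ℂ) (α : ℂ) : Submodule ℂ (ℂ → ℂ × ℂ) where
  carrier := kerSet Up Um α 0
  zero_mem' := by
    have h : Dbar (fun _ => 0) = 0 := by funext z; simp [Dbar]
    exact ⟨contDiff_const, fun z => by simp [h], fun z => by simp [h], by simp, by simp⟩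
  add_mem' := by
    rintro u v ⟨hu, hu1, hu2, hu3, hu4⟩ ⟨hv, hv1, hv2, hv3, hv4⟩
    have du := hu.differentiable (by simp)
    have dv := hv.differentiable (by simp)
    refine ⟨hu.add hv, fun z => ?_, fun z => ?_, fun γ hγ z => ?_, fun γ hγ z => ?_⟩
    · simp only [Pi.add_apply, Prod.fst_add, Prod.snd_add]
      rw [Dbar_add (du z).fst (dv z).fst]
      linear_combination hu1 z + hv1 z
    · simp only [Pi.add_apply, Prod.fst_add, Prod.snd_add]
      rw [Dbar_add (du z).snd (dv z).snd]
      linear_combination hu2 z + hv2 z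
    · simp only [Pi.add_apply, Prod.fst_add, hu3 γ hγ, hv3 γ hγ]; ring
    · simp only [Pi.add_apply, Prod.snd_add, hu4 γ hγ, hv4 γ hγ]; ring
  smul_mem' := by
    rintro c u ⟨hu, hu1, hu2, hu3, hu4⟩
    have du := hu.differentiable (by simp)
    refine ⟨hu.const_smul c, fun z => ?_, fun z => ?_, fun γ hγ z => ?_, fun γ hγ z => ?_⟩
    · simp only [Pi.smul_apply, Prod.smul_fst, Prod.smul_snd, smul_eq_mul]
      rw [Dbar_mul (differentiableAt_const c) (du z).fst,
        Dbar_of_differentiableAt (differentiableAt_const c)]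
      linear_combination c * hu1 z
    · simp only [Pi.smul_apply, Prod.smul_fst, Prod.smul_snd, smul_eq_mul]
      rw [Dbar_mul (differentiableAt_const c) (du z).snd,
        Dbar_of_differentiableAt (differentiableAt_const c)]
      linear_combination c * hu2 z
    · simp only [Pi.smul_apply, Prod.smul_fst, smul_eq_mul, hu3 γ hγ]; ring
    · simp only [Pi.smul_apply, Prod.smul_snd, smul_eq_mul, hu4 γ hγ]; ring

/-- The elements `u` of `Ker(α,0)` with `u (ω z) = c • u z`. -/
def rotSub (Up Um : ℂ → ℂ) (α c : ℂ) : Submodule ℂ (ℂ → ℂ × ℂ) where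
  carrier := {u | u ∈ kerSub Up Um α ∧ ∀ z, u (ω * z) = c • u z}
  zero_mem' := ⟨zero_mem _, by simp⟩
  add_mem' := fun hu hv => ⟨add_mem hu.1 hv.1, fun z => by simp [hu.2, hv.2]⟩
  smul_mem' := fun d u hu => ⟨Submodule.smul_mem _ d hu.1, fun z => by
    simp only [Pi.smul_apply, hu.2, smul_comm c d]⟩

lemma kerDim_eq (Up Um : ℂ → ℂ) (α : ℂ) :
    kerDim Up Um α 0 = Module.finrank ℂ (kerSub Up Um α) := by
  rw [kerDim, show kerSet Up Um α 0 = (kerSub Up Um α : Set (ℂ → ℂ × ℂ)) from rfl,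
    Submodule.span_eq]

lemma kerPDim_eq (Up Um : ℂ → ℂ) (α : ℂ) (p : ℕ) :
    kerPDim Up Um α p = Module.finrank ℂ (rotSub Up Um α (ω ^ (-(p : ℤ)))) := by
  rw [kerPDim, show kerPSet Up Um α p =
    (rotSub Up Um α (ω ^ (-(p : ℤ))) : Set (ℂ → ℂ × ℂ)) from rfl,
    Submodule.span_eq]

/-! ### Moving between the rotation eigenspaces -/

lemma eq_zero_of_rotation {f : ℂ → ℂ} (hf : Continuous f) {d : ℂ} (hd : d ≠ ω)
    (h : ∀ ζ, ω * ζ * f (ω * ζ) = d * (ζ * f ζ)) : f 0 = 0 := by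
  have key : ω * f (ω * 0) = d * f 0 := by
    refine eq_of_eventuallyEq_nhdsNE (f := fun ζ => ω * f (ω * ζ)) (g := fun ζ => d * f ζ)
      (by fun_prop) (by fun_prop) ?_
    filter_upwards [self_mem_nhdsWithin] with ζ hζ
    refine mul_left_cancel₀ (show ζ ≠ 0 from hζ) ?_
    linear_combination h ζ
  rw [mul_zero] at key
  have h0 : (d - ω) * f 0 = 0 := by linear_combination -key
  exact (mul_eq_zero.1 h0).resolve_left (sub_ne_zero.2 hd)

lemma eq_zero_of_eq_mul {c x : ℂ} (hc : c ≠ 1) (h : x = c * x) : x = 0 := by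
  have h0 : (c - 1) * x = 0 := by linear_combination -h
  exact (mul_eq_zero.1 h0).resolve_left (sub_ne_zero.2 hc)

/-- A kernel element times a compensated periodic meromorphic rotation eigenfunction. -/
lemma rotSub_ne_bot_of_mul {Up Um : ℂ → ℂ} {α c d : ℂ} {u : ℂ → ℂ × ℂ} {h : ℂ → ℂ}
    (hUp : Continuous Up) (hUm : Continuous Um) (hu : u ∈ rotSub Up Um α d) (hu0 : u ≠ 0)
    (hh : Meromorphic h) (htop : ∀ p, meromorphicOrderAt h p ≠ ⊤)
    (hper : ∀ γ ∈ Λ, ∀ z, h (z + γ) = h z) (hrot : ∀ z, h (ω * z) = c * h z)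
    (hord : ∀ p, ∃ m : ℕ, VanishesToOrder u p m ∧ ((-m : ℤ) : WithTop ℤ) ≤ meromorphicOrderAt h p) :
    rotSub Up Um α (c * d) ≠ ⊥ := by
  have hk : InKer Up Um α 0 u := hu.1
  obtain ⟨v, hv, hvu⟩ := hk.exists_eq_smul hUp hUm hh hper hord
  refine (Submodule.ne_bot_iff _).2 ⟨v, ⟨hv, ?_⟩,
    ne_zero_of_eventuallyEq_smul hk.1.continuous hu0 hh htop hvu⟩
  exact rotation_of_eventuallyEq_smul omega_ne_zero hv.1.continuous hvu hrot hu.2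

lemma exists_vanishesToOrder_wp_sub {Up Um : ℂ → ℂ} {α : ℂ} {u : ℂ → ℂ × ℂ}
    (hu : InKer Up Um α 0 u) {a : ℂ} (ha : VanishesToOrder u a 2) (p : ℂ) :
    ∃ m : ℕ, VanishesToOrder u p m ∧
      ((-m : ℤ) : WithTop ℤ) ≤ meromorphicOrderAt (fun z => wp (z - a)) p := by
  by_cases hp : p - a ∈ Λ
  · refine ⟨2, ?_, (order_wp_sub hp).ge⟩
    simpa using hu.vanishesToOrder_add ha hp
  · exact ⟨0, .zero hu.1 p, by simpa using (analyticAt_wp_sub hp).meromorphicOrderAt_nonneg⟩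

lemma wp_sub_periodic (a : ℂ) : ∀ γ ∈ Λ, ∀ z, wp (z + γ - a) = wp (z - a) := fun γ hγ z => by
  rw [← wp_add hγ (z - a)]
  congr 1
  ring

lemma InKer.exists_div {U : ℂ → ℂ} {α : ℂ} (hU : ContDiff ℝ (⊤ : ℕ∞) U)
    {u : ℂ → ℂ × ℂ} (hu : InKer U (fun z => U (-z)) α 0 u) {p : ℂ}
    (hp : u p = 0) : ∃ w, Continuous w ∧ (∀ z, u z = (z - p) • w z) ∧
      (w p = 0 → VanishesToOrder u p 2) := by
  obtain ⟨w, hw, huw⟩ := hu.isSol.exists_div (by fun_prop) (by fun_prop) hp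
  refine ⟨w, hw.contDiff.continuous, huw, fun hwp => ?_⟩
  obtain ⟨w', hw', hww'⟩ := hw.exists_div (by fun_prop) (by fun_prop) hwp
  exact ⟨w', hw'.contDiff, fun z => by rw [huw, hww', smul_smul, sq]⟩

lemma InKer.vanishesToOrder_one {U : ℂ → ℂ} {α : ℂ} (hU : ContDiff ℝ (⊤ : ℕ∞) U)
    {u : ℂ → ℂ × ℂ} (hu : InKer U (fun z => U (-z)) α 0 u) {p : ℂ}
    (hp : u p = 0) : VanishesToOrder u p 1 := by
  obtain ⟨w, hw, huw⟩ := hu.isSol.exists_div (by fun_prop) (by fun_prop) hp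
  exact ⟨w, hw.contDiff, fun z => by rw [huw, pow_one]⟩

lemma rotSub_one_ne_bot {U : ℂ → ℂ} {α : ℂ} (hU : ContDiff ℝ (⊤ : ℕ∞) U)
    (h : rotSub U (fun z => U (-z)) α (ω ^ 2) ≠ ⊥) :
    rotSub U (fun z => U (-z)) α 1 ≠ ⊥ := by
  obtain ⟨u, hu, hu0⟩ := (Submodule.ne_bot_iff _).1 h
  have hk : InKer U (fun z => U (-z)) α 0 u := hu.1
  have hrot := hu.2
  have h0 : u 0 = 0 := by
    have e := hrot 0
    rw [mul_zero] at e
    exact Prod.ext (eq_zero_of_eq_mul omega_sq_ne_one (congrArg Prod.fst e))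
      (eq_zero_of_eq_mul omega_sq_ne_one (congrArg Prod.snd e))
  obtain ⟨w, hw, huw, hvan⟩ := hk.exists_div hU h0
  have hwrot : ∀ ζ, (ω * ζ) • w (ω * ζ) = ω ^ 2 • ζ • w ζ := fun ζ => by
    have := hrot ζ
    rwa [huw, huw ζ, sub_zero, sub_zero] at this
  have hw0 : w 0 = 0 := Prod.ext
    (eq_zero_of_rotation (f := fun ζ => (w ζ).1) (by fun_prop) omega_sq_ne_omega
      fun ζ => congrArg Prod.fst (hwrot ζ))
    (eq_zero_of_rotation (f := fun ζ => (w ζ).2) (by fun_prop) omega_sq_ne_omega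
      fun ζ => congrArg Prod.snd (hwrot ζ))
  have key := rotSub_ne_bot_of_mul (c := ω) hU.continuous (by fun_prop) hu hu0
    (meromorphic_wp_sub 0) (order_wp_sub_ne_top 0) (wp_sub_periodic 0)
    (fun z => by rw [sub_zero, sub_zero, wp_omega_mul]) (exists_vanishesToOrder_wp_sub hk (hvan hw0))
  rwa [show ω * ω ^ 2 = 1 by linear_combination omega_cube] at key

lemma rotSub_omega_sq_ne_bot {U : ℂ → ℂ} {α : ℂ} (hU : ContDiff ℝ (⊤ : ℕ∞) U)
    (h : rotSub U (fun z => U (-z)) α 1 ≠ ⊥) :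
    rotSub U (fun z => U (-z)) α (ω ^ 2) ≠ ⊥ := by
  obtain ⟨u, hu, hu0⟩ := (Submodule.ne_bot_iff _).1 h
  have hk : InKer U (fun z => U (-z)) α 0 u := hu.1
  obtain ⟨-, -, -, hk1, hk2⟩ := id hk
  have hrot : ∀ z, u (ω * z) = u z := fun z => by rw [hu.2, one_smul]
  have h1 : u zS = 0 := by
    have e := hrot zS
    have e1 := hk1 _ neg_one_sub_omega_mem zS
    have e2 := hk2 _ neg_one_sub_omega_mem zS
    rw [← omega_mul_zS, e, exp_neg_pair_eq] at e1
    rw [← omega_mul_zS, e, exp_pair_eq] at e2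
    exact Prod.ext (eq_zero_of_eq_mul omega_ne_one e1) (eq_zero_of_eq_mul omega_sq_ne_one e2)
  have h2 : u (-zS) = 0 := by
    have e := hrot (-zS)
    have e0 : ω * -zS + (-1 - ω) = -zS := by linear_combination -omega_mul_zS
    have e1 := hk1 _ neg_one_sub_omega_mem (ω * -zS)
    have e2 := hk2 _ neg_one_sub_omega_mem (ω * -zS)
    rw [e0, e, exp_neg_pair_eq] at e1
    rw [e0, e, exp_pair_eq] at e2
    exact Prod.ext (eq_zero_of_eq_mul omega_ne_one e1) (eq_zero_of_eq_mul omega_sq_ne_one e2)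
  have key := rotSub_ne_bot_of_mul hU.continuous (by fun_prop) hu hu0
    meromorphic_wpProd order_wpProd_ne_top
    (fun γ hγ z => by rw [wpProd, wp_sub_periodic _ γ hγ, wp_sub_periodic _ γ hγ, wpProd])
    wpProd_omega_mul fun p => ?_
  · rwa [mul_one] at key
  by_cases hp1 : p - zS ∈ Λ
  · refine ⟨1, ?_, neg_one_le_order_wpProd p⟩
    simpa using hk.vanishesToOrder_add (hk.vanishesToOrder_one hU h1) hp1
  · by_cases hp2 : p + zS ∈ Λ
    · refine ⟨1, ?_, neg_one_le_order_wpProd p⟩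
      simpa using hk.vanishesToOrder_add (hk.vanishesToOrder_one hU h2) hp2
    · exact ⟨0, .zero hk.1 p, by simpa using order_wpProd_nonneg hp1 hp2⟩

lemma rotSub_omega_sq_ne_bot_of_apply_zS
    {U : ℂ → ℂ} {α : ℂ} (hU : ContDiff ℝ (⊤ : ℕ∞) U) {u : ℂ → ℂ × ℂ}
    (hu : u ∈ rotSub U (fun z => U (-z)) α ω) (hu0 : u ≠ 0) (hS : (u zS).1 = 0) :
    rotSub U (fun z => U (-z)) α (ω ^ 2) ≠ ⊥ := by
  have hk : InKer U (fun z => U (-z)) α 0 u := hu.1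
  obtain ⟨-, -, -, hk1, hk2⟩ := id hk
  have hrot := hu.2
  have key : ∀ ζ, (u (zS + ω * ζ)).1 = (u (zS + ζ)).1 ∧
      (u (zS + ω * ζ)).2 = ω ^ 2 * (u (zS + ζ)).2 := fun ζ => by
    have e := hrot (zS + ζ)
    have e0 : ω * (zS + ζ) = zS + ω * ζ + (-1 - ω) := by linear_combination omega_mul_zS
    have e1 := hk1 _ neg_one_sub_omega_mem (zS + ω * ζ)
    have e2 := hk2 _ neg_one_sub_omega_mem (zS + ω * ζ)
    rw [← e0, e, exp_neg_pair_eq, Prod.smul_fst, smul_eq_mul] at e1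
    rw [← e0, e, exp_pair_eq, Prod.smul_snd, smul_eq_mul] at e2
    refine ⟨(mul_left_cancel₀ omega_ne_zero e1).symm, ?_⟩
    linear_combination -ω * e2 - (u (zS + ω * ζ)).2 * omega_cube
  have hS0 : u zS = 0 := by
    refine Prod.ext hS (eq_zero_of_eq_mul omega_sq_ne_one ?_)
    simpa using (key 0).2
  obtain ⟨w, hw, huw, hvan⟩ := hk.exists_div hU hS0
  have hwS : w zS = 0 := by
    have e1 := eq_zero_of_rotation (f := fun ζ => (w (zS + ζ)).1) (by fun_prop)
      omega_ne_one.symm fun ζ => by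
        have := (key ζ).1
        rw [huw, huw (zS + ζ), add_sub_cancel_left, add_sub_cancel_left] at this
        rw [one_mul]
        exact this
    have e2 := eq_zero_of_rotation (f := fun ζ => (w (zS + ζ)).2) (by fun_prop)
      omega_sq_ne_omega fun ζ => by
        have := (key ζ).2
        rwa [huw, huw (zS + ζ), add_sub_cancel_left, add_sub_cancel_left] at this
    rw [add_zero] at e1 e2
    exact Prod.ext e1 e2
  have := rotSub_ne_bot_of_mul hU.continuous (by fun_prop) hu hu0
    (meromorphic_wp_sub zS) (order_wp_sub_ne_top zS) (wp_sub_periodic zS)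
    wp_omega_mul_sub_zS (exists_vanishesToOrder_wp_sub hk (hvan hwS))
  rwa [← sq] at this

lemma rotSub_omega_sq_ne_bot_of_finrank
    {U : ℂ → ℂ} {α : ℂ} (hU : ContDiff ℝ (⊤ : ℕ∞) U)
    (hrot : ∀ z, U (ω * z) = ω * U z)
    (h2 : Module.finrank ℂ (kerSub U (fun z => U (-z)) α) = 2) :
    rotSub U (fun z => U (-z)) α (ω ^ 2) ≠ ⊥ := by
  intro hbot
  have hbot0 : rotSub U (fun z => U (-z)) α 1 = ⊥ := by
    by_contra h
    exact rotSub_omega_sq_ne_bot hU h hbot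
  have hR : ∀ u ∈ kerSub U (fun z => U (-z)) α, u ∈ rotSub U (fun z => U (-z)) α ω := by
    intro u hu
    have hu1 : (fun z => u (ω * z)) ∈ kerSub U (fun z => U (-z)) α := InKer.rotate hrot hu
    have hu2 : (fun z => u (ω * (ω * z))) ∈ kerSub U (fun z => U (-z)) α :=
      InKer.rotate hrot hu1
    have h3 : ∀ z, ω * (ω * (ω * z)) = z := fun z => by linear_combination z * omega_cube
    have ha : (u + (fun z => u (ω * z)) + fun z => u (ω * (ω * z))) ∈
        rotSub U (fun z => U (-z)) α 1 := by
      refine ⟨add_mem (add_mem hu hu1) hu2, fun z => ?_⟩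
      simp only [Pi.add_apply, h3, one_smul]
      abel
    have hb : (u + ω • (fun z => u (ω * z)) + ω ^ 2 • fun z => u (ω * (ω * z))) ∈
        rotSub U (fun z => U (-z)) α (ω ^ 2) := by
      refine ⟨add_mem (add_mem hu (Submodule.smul_mem _ _ hu1)) (Submodule.smul_mem _ _ hu2),
        fun z => ?_⟩
      simp only [Pi.add_apply, Pi.smul_apply, h3, smul_add, smul_smul]
      rw [show ω ^ 2 * ω = 1 by linear_combination omega_cube,
        show ω ^ 2 * ω ^ 2 = ω by linear_combination ω * omega_cube, one_smul]
      abel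
    rw [hbot0, Submodule.mem_bot] at ha
    rw [hbot, Submodule.mem_bot] at hb
    refine ⟨hu, fun z => ?_⟩
    have key : ∀ x y t : ℂ, x + y + t = 0 → x + ω * y + ω ^ 2 * t = 0 → y = ω * x := by
      intro x y t hx hy
      refine mul_left_cancel₀ (mul_ne_zero omega_ne_zero (sub_ne_zero.2 omega_ne_one)) ?_
      linear_combination ω ^ 2 * hx - hy - x * omega_cube
    have haz := congrFun ha z
    have hbz := congrFun hb z
    exact Prod.ext (key _ _ _ (congrArg Prod.fst haz) (congrArg Prod.fst hbz))
      (key _ _ _ (congrArg Prod.snd haz) (congrArg Prod.snd hbz))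
  have hfin : Module.Finite ℂ (kerSub U (fun z => U (-z)) α) :=
    Module.finite_of_finrank_pos (by omega)
  let φ : kerSub U (fun z => U (-z)) α →ₗ[ℂ] ℂ :=
    { toFun := fun u => (u.1 zS).1
      map_add' := fun _ _ => rfl
      map_smul' := fun _ _ => rfl }
  have hker : LinearMap.ker φ ≠ ⊥ := LinearMap.ker_ne_bot_of_finrank_lt (by simp [h2])
  obtain ⟨u, hu, hu0⟩ := (Submodule.ne_bot_iff _).1 hker
  exact rotSub_omega_sq_ne_bot_of_apply_zS hU (hR u.1 u.2) (fun h => hu0 (Subtype.ext h))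
    (LinearMap.mem_ker.1 hu) hbot

lemma finrank_eq_one_of_disjoint {V : Type} [AddCommGroup V] [Module ℂ V] {W A B : Submodule ℂ V}
    (hW : Module.finrank ℂ W = 2) (hA : A ≤ W) (hB : B ≤ W) (hAB : A ⊓ B = ⊥) (hA0 : A ≠ ⊥)
    (hB0 : B ≠ ⊥) : Module.finrank ℂ A = 1 ∧ Module.finrank ℂ B = 1 := by
  have hfin : Module.Finite ℂ W := Module.finite_of_finrank_pos (by omega)
  have hfA : Module.Finite ℂ A := Submodule.finiteDimensional_of_le hA
  have hfB : Module.Finite ℂ B := Submodule.finiteDimensional_of_le hB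
  have h := Submodule.finrank_sup_add_finrank_inf_eq A B
  rw [hAB, finrank_bot, add_zero] at h
  have hle := Submodule.finrank_mono (sup_le hA hB)
  have hA1 := Submodule.one_le_finrank_iff.2 hA0
  have hB1 := Submodule.one_le_finrank_iff.2 hB0
  omega
/-- **Rigidity of two-fold degenerate magic angles.**
If `U` is a tunnelling potential with `conj (U (conj z)) = −U(−z)` and `α` is a two-fold
degenerate magic parameter (`dim Ker(α,k) = 2` for every `k`), then
`dim Ker₀(α) = 1` and `dim Ker₁(α) = 1`. -/
theorem rigidity_degenerate (U : ℂ → ℂ) (hU : IsTunnelling U)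
    (hsym : ∀ z : ℂ, (starRingEnd ℂ) (U ((starRingEnd ℂ) z)) = -U (-z))
    (α : ℂ) (hα : ∀ k : ℂ, kerDim U (fun z => U (-z)) α k = 2) :
    kerPDim U (fun z => U (-z)) α 0 = 1 ∧ kerPDim U (fun z => U (-z)) α 1 = 1 := by
  have h2 : Module.finrank ℂ (kerSub U (fun z => U (-z)) α) = 2 := kerDim_eq U _ α ▸ hα 0
  have hB := rotSub_omega_sq_ne_bot_of_finrank hU.1 hU.2.2 h2
  have hω : ω ^ (-((1 : ℕ) : ℤ)) = ω ^ 2 := by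
    rw [Nat.cast_one, zpow_neg_one]
    exact inv_eq_of_mul_eq_one_left (by linear_combination omega_cube)
  have h0 : ω ^ (-((0 : ℕ) : ℤ)) = 1 := by simp
  rw [kerPDim_eq, kerPDim_eq, hω, h0]
  refine finrank_eq_one_of_disjoint h2 (fun u hu => hu.1) (fun u hu => hu.1) ?_
    (rotSub_one_ne_bot hU.1 hB) hB
  rw [Submodule.eq_bot_iff]
  rintro u ⟨h1, h2⟩
  funext z
  have h : u z = ω ^ 2 • u z := by rw [← h2.2, h1.2, one_smul]
  exact Prod.ext (eq_zero_of_eq_mul omega_sq_ne_one (congrArg Prod.fst h))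
    (eq_zero_of_eq_mul omega_sq_ne_one (congrArg Prod.snd h))

end TBG
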